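/- Let k ≥ 2, ζ > 0, π_min > 0, and let C, C̃ ∈ ℝ^{k×k} satisfy σ_k(C) ≥ β^{2k} · 2^{−3k} · k^{−3} · π_min and |C̃_{ij} − C_{ij}| ≤ ε for all entries, where kε ≤ σ_k(C)/2. Then C and C̃ are invertible and ‖C̃^{−1} − C^{−1}‖ ≤ β^{−4k} · 2^{6k+1} · k^{7} · π_min^{−2} · ε. -/

import Mathlib

open Matrix

/-- The continuous linear map on Euclidean spaces associated with a real matrix. -/
noncomputable def matCLM {m n : Type*} [Fintype m] [Fintype n] [DecidableEq n]
    (A : Matrix m n ℝ) : EuclideanSpace ℝ n →L[ℝ] EuclideanSpace ℝ m :=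
  LinearMap.toContinuousLinearMap (Matrix.toEuclideanLin A)

/-- The operator norm of a matrix with respect to Euclidean norms. -/
noncomputable def opNorm {m n : Type*} [Fintype m] [Fintype n] [DecidableEq n]
    (A : Matrix m n ℝ) : ℝ :=
  ‖matCLM A‖

/-- The smallest singular value of a square matrix `A`:
the infimum of `‖A z‖` over unit vectors `z`. -/
noncomputable def sigmaMin {m n : Type*} [Fintype m] [Fintype n] [DecidableEq n]
    (A : Matrix m n ℝ) : ℝ :=
  sInf {t : ℝ | ∃ z : EuclideanSpace ℝ n, ‖z‖ = 1 ∧ t = ‖matCLM A z‖}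

/-- `β = (ζ/2)^(k−1) / (3k³)`. -/
noncomputable def beta (k : ℕ) (ζ : ℝ) : ℝ := (ζ / 2) ^ (k - 1) / (3 * (k : ℝ) ^ 3)

theorem matCLM_mul_apply {l m n : Type*} [Fintype l] [Fintype m] [Fintype n] [DecidableEq m]
    [DecidableEq n] (A : Matrix l m ℝ) (B : Matrix m n ℝ) (z : EuclideanSpace ℝ n) :
    matCLM (A * B) z = matCLM A (matCLM B z) := by
  simp [matCLM, Matrix.toLpLin_apply, Matrix.mulVec_mulVec]

theorem matCLM_sub_apply {m n : Type*} [Fintype m] [Fintype n] [DecidableEq n]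
    (A B : Matrix m n ℝ) (z : EuclideanSpace ℝ n) :
    matCLM (A - B) z = matCLM A z - matCLM B z := by
  simp [matCLM, map_sub]

theorem matCLM_one_apply {n : Type*} [Fintype n] [DecidableEq n] (z : EuclideanSpace ℝ n) :
    matCLM (1 : Matrix n n ℝ) z = z := by
  simp [matCLM]

theorem matCLM_apply_coord {m n : Type*} [Fintype m] [Fintype n] [DecidableEq n]
    (A : Matrix m n ℝ) (z : EuclideanSpace ℝ n) (i : m) :
    matCLM A z i = ∑ j, A i j * z j := by
  simp [matCLM, Matrix.toLpLin_apply, Matrix.mulVec, dotProduct]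

theorem sigmaMin_mul_norm_le {m n : Type*} [Fintype m] [Fintype n] [DecidableEq n]
    (A : Matrix m n ℝ) (z : EuclideanSpace ℝ n) :
    sigmaMin A * ‖z‖ ≤ ‖matCLM A z‖ := by
  rcases eq_or_ne z 0 with rfl | hz
  · simp
  have hz' : 0 < ‖z‖ := norm_pos_iff.mpr hz
  have h : sigmaMin A ≤ ‖matCLM A (‖z‖⁻¹ • z)‖ := by
    refine csInf_le ⟨0, ?_⟩ ⟨‖z‖⁻¹ • z, ?_, rfl⟩
    · rintro t ⟨y, -, rfl⟩
      exact norm_nonneg _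
    · rw [norm_smul, norm_inv, norm_norm, inv_mul_cancel₀ hz'.ne']
  rw [map_smul, norm_smul, norm_inv, norm_norm, inv_mul_eq_div] at h
  exact (le_div_iff₀ hz').mp h

theorem isUnit_of_mul_norm_le {n : Type*} [Fintype n] [DecidableEq n] {A : Matrix n n ℝ} {c : ℝ}
    (hc : 0 < c) (h : ∀ z, c * ‖z‖ ≤ ‖matCLM A z‖) : IsUnit A := by
  refine Matrix.mulVec_injective_iff_isUnit.mp fun x y hxy => ?_
  have hz : matCLM A (WithLp.toLp 2 (x - y)) = 0 := by
    simp [matCLM, Matrix.toLpLin_apply, Matrix.mulVec_sub, hxy]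
  have h0 := h (WithLp.toLp 2 (x - y))
  rw [hz, norm_zero] at h0
  have h1 : WithLp.toLp 2 (x - y) = 0 :=
    norm_le_zero_iff.mp (nonpos_of_mul_nonpos_right h0 hc)
  exact sub_eq_zero.mp ((WithLp.toLp_eq_zero 2).mp h1)

theorem norm_matCLM_le_of_entry_le {k : ℕ} {E : Matrix (Fin k) (Fin k) ℝ} {ε : ℝ} (hε : 0 ≤ ε)
    (hE : ∀ i j, |E i j| ≤ ε) (z : EuclideanSpace ℝ (Fin k)) :
    ‖matCLM E z‖ ≤ k * ε * ‖z‖ := by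
  refine abs_le_of_sq_le_sq' ?_ (by positivity) |>.2
  rw [EuclideanSpace.norm_sq_eq, mul_pow]
  calc ∑ i, ‖matCLM E z i‖ ^ 2 ≤ ∑ _i : Fin k, k * ε ^ 2 * ‖z‖ ^ 2 := by
        refine Finset.sum_le_sum fun i _ => ?_
        rw [matCLM_apply_coord, Real.norm_eq_abs, sq_abs]
        refine (Finset.sum_mul_sq_le_sq_mul_sq _ _ _).trans ?_
        rw [EuclideanSpace.norm_sq_eq]
        simp only [Real.norm_eq_abs, sq_abs]
        gcongr
        calc ∑ j, E i j ^ 2 ≤ ∑ _j : Fin k, ε ^ 2 :=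
              Finset.sum_le_sum fun j _ => sq_le_sq' (abs_le.mp (hE i j)).1 (abs_le.mp (hE i j)).2
          _ = k * ε ^ 2 := by simp
    _ = (k * ε) ^ 2 * ‖z‖ ^ 2 := by simp; ring

theorem opNorm_inv_sub_inv_le {n : Type*} [Fintype n] [DecidableEq n] {A B : Matrix n n ℝ}
    {a b d : ℝ} (ha : 0 < a) (hb : 0 < b) (hd : 0 ≤ d)
    (hA : ∀ z, a * ‖z‖ ≤ ‖matCLM A z‖) (hB : ∀ z, b * ‖z‖ ≤ ‖matCLM B z‖)
    (hBA : ∀ z, ‖matCLM (B - A) z‖ ≤ d * ‖z‖) :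
    opNorm (B⁻¹ - A⁻¹) ≤ d / (b * a) := by
  have hdetA := (Matrix.isUnit_iff_isUnit_det A).mp (isUnit_of_mul_norm_le ha hA)
  have hdetB := (Matrix.isUnit_iff_isUnit_det B).mp (isUnit_of_mul_norm_le hb hB)
  refine ContinuousLinearMap.opNorm_le_bound _ (by positivity) fun w => ?_
  have hx : a * ‖matCLM A⁻¹ w‖ ≤ ‖w‖ := by
    refine (hA _).trans_eq ?_
    rw [← matCLM_mul_apply, Matrix.mul_nonsing_inv A hdetA, matCLM_one_apply]
  have hy : matCLM B (matCLM (B⁻¹ - A⁻¹) w) = -matCLM (B - A) (matCLM A⁻¹ w) := by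
    rw [matCLM_sub_apply, map_sub, matCLM_sub_apply, ← matCLM_mul_apply B B⁻¹,
      ← matCLM_mul_apply A, Matrix.mul_nonsing_inv A hdetA, Matrix.mul_nonsing_inv B hdetB]
    abel
  have h := hB (matCLM (B⁻¹ - A⁻¹) w)
  rw [hy, norm_neg] at h
  rw [div_mul_eq_mul_div, le_div_iff₀ (mul_pos hb ha)]
  calc ‖matCLM (B⁻¹ - A⁻¹) w‖ * (b * a) = a * (b * ‖matCLM (B⁻¹ - A⁻¹) w‖) := by ring
    _ ≤ a * (d * ‖matCLM A⁻¹ w‖) := mul_le_mul_of_nonneg_left (h.trans (hBA _)) ha.le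
    _ = d * (a * ‖matCLM A⁻¹ w‖) := by ring
    _ ≤ d * ‖w‖ := by gcongr

/-- Stability of inversion of the observable matrix: if
`σ_k(C) ≥ β^{2k}·2^(−3k)·k^(−3)·π_min` and `C̃` agrees with `C` entrywise up to `ε`, with
`kε ≤ σ_k(C)/2`, then `C` and `C̃` are invertible and
`‖C̃⁻¹ − C⁻¹‖ ≤ β^(−4k)·2^(6k+1)·k⁷·π_min^(−2)·ε`. -/
theorem stmt17 {k : ℕ} (hk : 2 ≤ k) (ζ : ℝ) (hζ : 0 < ζ)
    (πmin : ℝ) (hπmin : 0 < πmin)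
    (C Ct : Matrix (Fin k) (Fin k) ℝ) (ε : ℝ)
    (hσ : beta k ζ ^ (2 * k) / 2 ^ (3 * k) / (k : ℝ) ^ 3 * πmin ≤ sigmaMin C)
    (hE : ∀ i j, |Ct i j - C i j| ≤ ε)
    (hkε : (k : ℝ) * ε ≤ sigmaMin C / 2) :
    IsUnit C ∧ IsUnit Ct ∧
      opNorm (Ct⁻¹ - C⁻¹) ≤
        (beta k ζ)⁻¹ ^ (4 * k) * 2 ^ (6 * k + 1) * (k : ℝ) ^ 7 * πmin⁻¹ ^ 2 * ε := by
  have hk0 : (0 : ℝ) < k := by positivity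
  have hβ : 0 < beta k ζ := by unfold beta; positivity
  set τ := beta k ζ ^ (2 * k) / 2 ^ (3 * k) / (k : ℝ) ^ 3 * πmin with hτ
  have hτ0 : 0 < τ := by positivity
  have hs : 0 < sigmaMin C := hτ0.trans_le hσ
  have hε : 0 ≤ ε := (abs_nonneg _).trans (hE ⟨0, by omega⟩ ⟨0, by omega⟩)
  have hC := sigmaMin_mul_norm_le C
  have hD : ∀ z, ‖matCLM (Ct - C) z‖ ≤ k * ε * ‖z‖ := norm_matCLM_le_of_entry_le hε hE
  have hCt : ∀ z, sigmaMin C / 2 * ‖z‖ ≤ ‖matCLM Ct z‖ := fun z => by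
    have h1 := hD z
    rw [matCLM_sub_apply] at h1
    have h2 := norm_sub_norm_le (matCLM C z) (matCLM Ct z)
    rw [norm_sub_rev] at h2
    have h3 := mul_le_mul_of_nonneg_right hkε (norm_nonneg z)
    linarith [hC z]
  refine ⟨isUnit_of_mul_norm_le hs hC, isUnit_of_mul_norm_le (half_pos hs) hCt, ?_⟩
  calc opNorm (Ct⁻¹ - C⁻¹) ≤ k * ε / (sigmaMin C / 2 * sigmaMin C) :=
        opNorm_inv_sub_inv_le hs (half_pos hs) (by positivity) hC hCt hD
    _ ≤ k * ε / (τ / 2 * τ) := by gcongr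
    _ = _ := by
        rw [hτ, pow_succ 2 (6 * k), show 4 * k = 2 * k * 2 by ring,
          show 6 * k = 3 * k * 2 by ring, pow_mul _ (2 * k), pow_mul _ (3 * k), inv_pow]
        field_simp
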